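/- arXiv:1108.3185 — 4 statements merged into one kernel-verified Lean document; each statement's English description precedes it below -/
import Mathlib

section
/- Let f₀(r,p) := Z⁻¹ M(p) ρ₀(r) with ρ₀ : ℝ³ → ℝ, and let f̃ : ℝ³ × ℝ³ → ℝ be continuously differentiable in p with the integrals below finite. Then N₀(f̃, f₀)(r,p) = − f₀(r,p) · ( p · ∫ g(r,r') Z₂(r,r') ((p' + ∇_{p'}) f̃)(r',p') dr' dp' ). -/
open MeasureTheory Real Finset

noncomputable section

abbrev V3 : Type := Fin 3 → ℝ

/-- The (unnormalized) Maxwellian `exp(-|p|²/2)`. -/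
def Mw (p : V3) : ℝ := Real.exp (-(∑ i, p i ^ 2) / 2)

/-- The normalization constant `Z = (2π)^{3/2}`. -/
def Zc : ℝ := (2 * Real.pi) ^ ((3 : ℝ) / 2)

/-- Partial derivative in direction `i`. -/
def pd (i : Fin 3) (f : V3 → ℝ) (x : V3) : ℝ := fderiv ℝ f x (Pi.single i 1)

/-- `(p + ∇_p) f` as a vector field in `p`. -/
def pg (f : V3 → ℝ) (p : V3) : V3 := fun i => p i * f p + pd i f p

/-- Divergence in `p`. -/
def divP (F : V3 → V3) (p : V3) : ℝ := ∑ i, pd i (fun q => F q i) p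

/-- The operator `L₀ f = div_p[(p + ∇_p) f]`. -/
def L0 (f : V3 → V3 → ℝ) (r p : V3) : ℝ := divP (pg (f r)) p

/-- The nonlinear (hydrodynamic-interaction) operator `N₀(f, f̃)`. -/
def N0 (g : V3 → V3 → ℝ) (Z1 Z2 : V3 → V3 → Matrix (Fin 3) (Fin 3) ℝ)
    (f ft : V3 → V3 → ℝ) (r p : V3) : ℝ :=
  divP (fun q i =>
    (∑ j, (∫ r', ∫ p', g r r' * f r' p' * Z1 r r' i j) * pg (ft r) q j)
      + (∫ r', ∫ p', g r r' * ∑ j, Z2 r r' i j * pg (f r') p' j) * ft r q) p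

/-- The transport operator `L₁ f = -p·∇_r f + ∇_r V₁ · ∇_p f`. -/
def L1 (V1 : V3 → ℝ) (f : V3 → V3 → ℝ) (r p : V3) : ℝ :=
  -(∑ i, p i * pd i (fun s => f s p) r) + ∑ i, pd i V1 r * pd i (f r) p

/-- The nonlinear (interaction-potential) operator `N₁(f, f̃)`. -/
def N1 (g : V3 → V3 → ℝ) (V2 : V3 → V3 → ℝ) (f ft : V3 → V3 → ℝ) (r p : V3) : ℝ :=
  ∑ i, (∫ r', ∫ p', f r' p' * g r r' * pd i (fun s => V2 s r') r) * pd i (ft r) p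

/-- Probabilists' Hermite polynomial, evaluated at a real number. -/
def Hp (n : ℕ) (x : ℝ) : ℝ := Polynomial.aeval x (Polynomial.hermite n)

/-- Tensor-product Hermite polynomial `P_{n,a}(p) = ∏ᵢ H_{aᵢ}(pᵢ)`. -/
def Pna (a : Fin 3 → ℕ) (p : V3) : ℝ := ∏ i, Hp (a i) (p i)

/-- Pairwise-additive friction tensor blocks. -/
def Gam {N : ℕ} (Z1 Z2 : V3 → V3 → Matrix (Fin 3) (Fin 3) ℝ) (rs : Fin N → V3) (i j : Fin N) :
    Matrix (Fin 3) (Fin 3) ℝ :=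
  if i = j then 1 + ∑ l ∈ Finset.univ.filter (· ≠ i), Z1 (rs i) (rs l)
  else Z2 (rs i) (rs j)

/-- Insert a value in coordinate `0` of an `N`-tuple. -/
def ins {N : ℕ} [NeZero N] {α : Type*} (x : α) (y : {i : Fin N // i ≠ 0} → α) : Fin N → α :=
  fun i => if h : i = 0 then x else y ⟨i, h⟩

/-- Insert values in coordinates `0` and `1` of an `N`-tuple. -/
def ins2 {N : ℕ} [NeZero N] {α : Type*} (x x' : α) (y : {i : Fin N // i ≠ 0 ∧ i ≠ 1} → α) :
    Fin N → α :=
  fun i => if h0 : i = 0 then x else if h1 : i = 1 then x' else y ⟨i, h0, h1⟩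

/-- Partial derivative `∂/∂(xᵢ)ₖ` for functions on `(ℝ³)ᴺ`. -/
def PDN {N : ℕ} (i : Fin N) (k : Fin 3) (F : (Fin N → V3) → ℝ) (x : Fin N → V3) : ℝ :=
  fderiv ℝ F x (Pi.single i (Pi.single k 1))

/-- The partial derivatives of a multiple of the Maxwellian. -/
lemma pd_const_mul_Mw (c : ℝ) (i : Fin 3) (p : V3) :
    pd i (fun q => c * Mw q) p = -(p i) * (c * Mw p) := by
  have hsum : HasFDerivAt (fun q : V3 => ∑ j, q j ^ 2)
      (∑ j, (2 * p j) • ContinuousLinearMap.proj (R := ℝ) (φ := fun _ : Fin 3 => ℝ) j) p := by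
    refine HasFDerivAt.fun_sum fun j _ => ?_
    simpa using (hasFDerivAt_apply (𝕜 := ℝ) (F' := fun _ : Fin 3 => ℝ) j p).pow 2
  have h := (hsum.const_mul (-1 / 2)).exp.const_mul c
  have hfun : (fun q => c * Mw q) =
      fun q : V3 => c * Real.exp (-1 / 2 * ∑ j, q j ^ 2) := by
    funext q
    unfold Mw
    congr 2
    ring
  have hM : Mw p = Real.exp (-1 / 2 * ∑ j, p j ^ 2) := by
    unfold Mw
    congr 1
    ring
  rw [pd, hfun, h.fderiv, hM]
  simp [Pi.single_apply]
  ring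

/-- The vector field `(p + ∇_p)` annihilates multiples of the Maxwellian. -/
lemma pg_const_mul_Mw (c : ℝ) (p : V3) : pg (fun q => c * Mw q) p = 0 := by
  funext i
  simp only [pg, pd_const_mul_Mw, Pi.zero_apply]
  ring

/-- for the Maxwellian `f₀(r,p) = Z⁻¹ M(p) ρ₀(r)`,
`N₀(f̃, f₀)(r,p) = − f₀(r,p) (p · ∫ g Z₂ (p' + ∇_{p'}) f̃ dr' dp')`. -/
theorem stmt_3 (g : V3 → V3 → ℝ) (Z1 Z2 : V3 → V3 → Matrix (Fin 3) (Fin 3) ℝ)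
    (hZ1 : ∀ x y, (Z1 x y).IsSymm) (hZ2 : ∀ x y, (Z2 x y).IsSymm)
    (ρ0 : V3 → ℝ)
    (f0 : V3 → V3 → ℝ) (hf0 : ∀ r p, f0 r p = Zc⁻¹ * Mw p * ρ0 r)
    (ft : V3 → V3 → ℝ) (hft : ∀ r, ContDiff ℝ 1 (ft r)) :
    ∀ r p, N0 g Z1 Z2 ft f0 r p =
      -(f0 r p) * ∑ i, p i * ∫ r', ∫ p', g r r' * ∑ j, Z2 r r' i j * pg (ft r') p' j := by
  intro r p
  have hf : f0 r = fun q => (Zc⁻¹ * ρ0 r) * Mw q := by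
    funext q
    rw [hf0]
    ring
  unfold N0 divP
  simp only [hf, pg_const_mul_Mw, Pi.zero_apply, mul_zero, Finset.sum_const_zero, zero_add,
    ← mul_assoc, pd_const_mul_Mw]
  simp only [mul_assoc, Finset.mul_sum]
  refine Finset.sum_congr rfl fun i _ => ?_
  ring
end
end

section
/- Let f₀(r,p) := Z⁻¹ M(p) ρ₀(r) with ρ₀ : ℝ³ → ℝ continuously differentiable and integrable, let V₁ : ℝ³ → ℝ and V₂ : ℝ³ × ℝ³ → ℝ be continuously differentiable, and assume the integrals below converge. Then for every r ∈ ℝ³, ∫_{ℝ³} ( L₁f₀ + N₁(f₀, f₀) )(r,p) dp = 0. Consequently −L₁f₀ − N₁(f₀,f₀) is orthogonal in the weighted inner product ⟨u, w⟩_{f₀⁻¹} := ∫∫ f₀⁻¹ u w dr dp to every function of the form M(p)φ(r), i.e. to the null space of the operator L̃. -/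
open MeasureTheory Real Finset

noncomputable section

theorem integral_eq_zero_of_odd {h : V3 → ℝ} (hh : ∀ p, h (-p) = -h p) : ∫ p, h p = 0 := by
  have key := integral_neg_eq_self h volume
  simp only [hh, integral_neg] at key
  linarith

theorem Mw_neg (p : V3) : Mw (-p) = Mw p := by
  simp [Mw]

theorem pd_neg_of_even {h : V3 → ℝ} (hh : ∀ p, h (-p) = h p) (i : Fin 3) (p : V3) :
    pd i h (-p) = -pd i h p := by
  have key := (ContinuousLinearEquiv.neg ℝ (M := V3)).comp_right_fderiv (f := h) (x := p)
  have hcomp : h ∘ ContinuousLinearEquiv.neg ℝ (M := V3) = h := funext fun q => hh q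
  rw [hcomp] at key
  simp [pd, key]

theorem L1_neg_of_even (V1 : V3 → ℝ) {f : V3 → V3 → ℝ} (hf : ∀ r p, f r (-p) = f r p)
    (r p : V3) : L1 V1 f r (-p) = -L1 V1 f r p := by
  simp only [L1, hf, pd_neg_of_even (hf r), Pi.neg_apply, neg_mul, mul_neg,
    sum_neg_distrib]
  ring

theorem N1_neg_of_even (g V2 : V3 → V3 → ℝ) (f : V3 → V3 → ℝ) {ft : V3 → V3 → ℝ}
    (hf : ∀ r p, ft r (-p) = ft r p) (r p : V3) :
    N1 g V2 f ft r (-p) = -N1 g V2 f ft r p := by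
  simp only [N1, pd_neg_of_even (hf r), mul_neg, sum_neg_distrib]

/-- `∫ (L₁f₀ + N₁(f₀,f₀)) dp = 0`, hence `−L₁f₀ − N₁(f₀,f₀)` is
orthogonal, in the inner product weighted by `f₀⁻¹`, to every function of the form
`M(p) φ(r)`, i.e. to the null space of `L̃`. -/
theorem stmt_7 (g : V3 → V3 → ℝ) (V1 : V3 → ℝ) (V2 : V3 → V3 → ℝ)
    (hV1 : ContDiff ℝ 1 V1) (hV2 : ContDiff ℝ 1 (Function.uncurry V2))
    (ρ0 : V3 → ℝ) (hρ0C : ContDiff ℝ 1 ρ0) (hρ0I : Integrable ρ0)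
    (f0 : V3 → V3 → ℝ) (hf0 : ∀ r p, f0 r p = Zc⁻¹ * Mw p * ρ0 r)
    (hint : ∀ (r : V3) (i : Fin 3),
      Integrable (fun r' => ρ0 r' * g r r' * pd i (fun s => V2 s r') r)) :
    (∀ r : V3, (∫ p, (L1 V1 f0 r p + N1 g V2 f0 f0 r p)) = 0) ∧
    (∀ φ : V3 → ℝ,
      (∫ r, ∫ p, (f0 r p)⁻¹ * (-(L1 V1 f0 r p + N1 g V2 f0 f0 r p)) * (Mw p * φ r)) = 0) := by
  have heven : ∀ r p, f0 r (-p) = f0 r p := fun r p => by rw [hf0, hf0, Mw_neg]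
  refine ⟨fun r => integral_eq_zero_of_odd fun p => ?_, fun φ => ?_⟩
  · rw [L1_neg_of_even V1 heven, N1_neg_of_even g V2 f0 heven]
    ring
  · have hinner : ∀ r, (∫ p, (f0 r p)⁻¹ * (-(L1 V1 f0 r p + N1 g V2 f0 f0 r p)) *
        (Mw p * φ r)) = 0 := fun r => integral_eq_zero_of_odd fun p => by
      rw [L1_neg_of_even V1 heven, N1_neg_of_even g V2 f0 heven, heven, Mw_neg]
      ring
    simp only [hinner, integral_zero]
end
end

section
/- Let f₀(r,p) := Z⁻¹ M(p) ρ₀(r) with ρ₀ : ℝ³ → ℝ integrable, and let f₁(r,p) := Z⁻¹ M(p) ( a(r)·p + ψ(r) ), where a : ℝ³ → ℝ³ and ψ : ℝ³ → ℝ are such that all integrals below converge. Then L̃f₁ := L₀f₁ + N₀(f₀, f₁) + N₀(f₁, f₀) satisfies L̃f₁(r,p) = − Z⁻¹ M(p) · ( p · [ a(r) + ( ∫ g(r,r') ρ₀(r') Z₁(r,r') dr' ) a(r) + ρ₀(r) ∫ g(r,r') Z₂(r,r') a(r') dr' ] ). In particular, if L̃f₁ = Z⁻¹ M(p) (ã(r)·p)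 then a solves the Fredholm equation a(r) + (∫ g ρ₀ Z₁ dr') a(r) + ρ₀(r) ∫ g Z₂ a(r') dr' = −ã(r). -/
open MeasureTheory Real Finset

noncomputable section

theorem hasFDerivAt_Mw (p : V3) :
    HasFDerivAt Mw
      (-(Mw p) • ∑ k, p k • (ContinuousLinearMap.proj k : V3 →L[ℝ] ℝ)) p := by
  have hsq : HasFDerivAt (fun q : V3 => ∑ k, q k ^ 2)
      (∑ k, (2 * p k) • (ContinuousLinearMap.proj k : V3 →L[ℝ] ℝ)) p := by
    refine HasFDerivAt.fun_sum fun k _ => ?_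
    simpa using (hasFDerivAt_apply (𝕜 := ℝ) k p).pow 2
  have h := (hsq.const_mul (-(1 / 2 : ℝ))).exp
  have hfun : (fun q : V3 => Real.exp (-(1 / 2) * ∑ k, q k ^ 2)) = Mw := by
    funext q
    simp only [Mw]
    ring_nf
  refine (hfun ▸ h).congr_fderiv ?_
  rw [show Real.exp (-(1 / 2) * ∑ k, p k ^ 2) = Mw p from congrFun hfun p]
  ext v
  simp only [Fin.sum_univ_three, add_apply, smul_apply, ContinuousLinearMap.proj_apply,
    smul_eq_mul]
  ring

/-- Partial derivatives of a Maxwellian times an affine function. -/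
theorem pd_Mw_mul_affine (c : ℝ) (b : V3) (d : ℝ) (i : Fin 3) (p : V3) :
    pd i (fun q => c * Mw q * (∑ k, b k * q k + d)) p =
      c * Mw p * (b i - p i * (∑ k, b k * p k + d)) := by
  have hlin : HasFDerivAt (fun q : V3 => ∑ k, b k * q k + d)
      (∑ k, b k • (ContinuousLinearMap.proj k : V3 →L[ℝ] ℝ)) p :=
    (HasFDerivAt.fun_sum fun k _ =>
      (hasFDerivAt_apply (𝕜 := ℝ) k p).const_mul (b k)).add_const d
  have h := ((hasFDerivAt_Mw p).const_mul c).mul hlin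
  have hpd := congrArg (fun L : V3 →L[ℝ] ℝ => L (Pi.single i 1)) h.fderiv
  refine hpd.trans ?_
  simp only [add_apply, smul_apply, _root_.sum_apply, ContinuousLinearMap.proj_apply, smul_eq_mul,
    Pi.single_apply, mul_ite, mul_one, mul_zero, Finset.sum_ite_eq', Finset.mem_univ, if_true]
  ring

theorem pg_Mw_mul_affine (c : ℝ) (b : V3) (d : ℝ) (p : V3) (i : Fin 3) :
    pg (fun q => c * Mw q * (∑ k, b k * q k + d)) p i = c * Mw p * b i := by
  simp only [pg, pd_Mw_mul_affine]
  ring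

theorem pg_Mw_mul (c d : ℝ) (p : V3) (i : Fin 3) :
    pg (fun q => c * Mw q * d) p i = 0 := by
  simpa using pg_Mw_mul_affine c 0 d p i

theorem divP_Mw_mul (c : ℝ) (b : V3) (p : V3) :
    divP (fun q i => c * Mw q * b i) p = -(c * Mw p) * ∑ i, p i * b i := by
  have h (i : Fin 3) : pd i (fun q => c * Mw q * b i) p = -(c * Mw p) * (p i * b i) := by
    have := pd_Mw_mul_affine c 0 (b i) i p
    simp only [Pi.zero_apply, zero_mul, Finset.sum_const_zero, zero_add] at this
    rw [this]
    ring
  simp only [divP, h, Finset.mul_sum]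

theorem Zc_pos : 0 < Zc := Real.rpow_pos_of_pos (by positivity) _

theorem integral_Mw : ∫ p, Mw p = Zc := by
  have hprod (p : V3) : Mw p = ∏ i, Real.exp (-(1 / 2) * p i ^ 2) := by
    rw [← Real.exp_sum, Mw, ← Finset.mul_sum]
    ring_nf
  simp only [hprod]
  rw [integral_fintype_prod_volume_eq_prod (fun (_ : Fin 3) (x : ℝ) => Real.exp (-(1 / 2) * x ^ 2))]
  simp only [integral_gaussian, Finset.prod_const, Finset.card_univ, Fintype.card_fin, Zc]
  rw [Real.sqrt_eq_rpow, ← Real.rpow_natCast, ← Real.rpow_mul (by positivity)]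
  congr 1 <;> norm_num
  ring

theorem integral_Zc_inv_mul_Mw : ∫ p, Zc⁻¹ * Mw p = 1 := by
  rw [integral_const_mul, integral_Mw, inv_mul_cancel₀ Zc_pos.ne']

/-- action of `L̃ = L₀ + N₀(f₀,·) + N₀(·,f₀)` on
`f₁ = Z⁻¹ M (a·p + ψ)`, and the resulting Fredholm equation for `a`. -/
theorem stmt_11 (g : V3 → V3 → ℝ) (Z1 Z2 : V3 → V3 → Matrix (Fin 3) (Fin 3) ℝ)
    (hZ1 : ∀ x y, (Z1 x y).IsSymm) (hZ2 : ∀ x y, (Z2 x y).IsSymm)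
    (ρ0 : V3 → ℝ) (hρ0 : Integrable ρ0)
    (a : V3 → V3) (ψ : V3 → ℝ)
    (f0 : V3 → V3 → ℝ) (hf0 : ∀ r p, f0 r p = Zc⁻¹ * Mw p * ρ0 r)
    (f1 : V3 → V3 → ℝ)
    (hf1 : ∀ r p, f1 r p = Zc⁻¹ * Mw p * (∑ i, a r i * p i + ψ r))
    (hintZ1 : ∀ (r : V3) (i j : Fin 3),
      Integrable (fun r' => g r r' * ρ0 r' * Z1 r r' i j))
    (hintZ2 : ∀ (r : V3) (i : Fin 3),
      Integrable (fun r' => g r r' * ∑ j, Z2 r r' i j * a r' j)) :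
    (∀ r p,
      L0 f1 r p + N0 g Z1 Z2 f0 f1 r p + N0 g Z1 Z2 f1 f0 r p =
        -(Zc⁻¹ * Mw p) *
          ∑ i, p i *
            (a r i + (∑ j, (∫ r', g r r' * ρ0 r' * Z1 r r' i j) * a r j)
              + ρ0 r * ∫ r', g r r' * ∑ j, Z2 r r' i j * a r' j)) ∧
    (∀ at' : V3 → V3,
      (∀ r p, L0 f1 r p + N0 g Z1 Z2 f0 f1 r p + N0 g Z1 Z2 f1 f0 r p =
        Zc⁻¹ * Mw p * ∑ i, at' r i * p i) →
      ∀ r i, a r i + (∑ j, (∫ r', g r r' * ρ0 r' * Z1 r r' i j) * a r j)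
              + ρ0 r * (∫ r', g r r' * ∑ j, Z2 r r' i j * a r' j)
          = -(at' r i)) := by
  have hf0' (r : V3) : f0 r = fun q => Zc⁻¹ * Mw q * ρ0 r := funext (hf0 r)
  have hf1' (r : V3) : f1 r = fun q => Zc⁻¹ * Mw q * (∑ i, a r i * q i + ψ r) :=
    funext (hf1 r)
  have hpg0 (r p : V3) (i : Fin 3) : pg (f0 r) p i = 0 := by
    rw [hf0', pg_Mw_mul]
  have hpg1 (r p : V3) (i : Fin 3) : pg (f1 r) p i = Zc⁻¹ * Mw p * a r i := by
    rw [hf1', pg_Mw_mul_affine]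
  have hA (r r' : V3) (i j : Fin 3) :
      ∫ p', g r r' * f0 r' p' * Z1 r r' i j = g r r' * ρ0 r' * Z1 r r' i j := by
    calc ∫ p', g r r' * f0 r' p' * Z1 r r' i j
        = ∫ p', (g r r' * ρ0 r' * Z1 r r' i j) * (Zc⁻¹ * Mw p') := by
          congr 1 with p'
          rw [hf0]
          ring
      _ = g r r' * ρ0 r' * Z1 r r' i j := by
          rw [integral_const_mul, integral_Zc_inv_mul_Mw, mul_one]
  have hB (r r' : V3) (i : Fin 3) :
      ∫ p', g r r' * ∑ j, Z2 r r' i j * pg (f1 r') p' j =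
        g r r' * ∑ j, Z2 r r' i j * a r' j := by
    calc ∫ p', g r r' * ∑ j, Z2 r r' i j * pg (f1 r') p' j
        = ∫ p', (g r r' * ∑ j, Z2 r r' i j * a r' j) * (Zc⁻¹ * Mw p') := by
          congr 1 with p'
          simp only [hpg1, Fin.sum_univ_three]
          ring
      _ = g r r' * ∑ j, Z2 r r' i j * a r' j := by
          rw [integral_const_mul, integral_Zc_inv_mul_Mw, mul_one]
  have hL (r p : V3) : L0 f1 r p = -(Zc⁻¹ * Mw p) * ∑ i, p i * a r i := by
    rw [L0, ← divP_Mw_mul]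
    congr 1
    funext q i
    exact hpg1 r q i
  have hN01 (r p : V3) : N0 g Z1 Z2 f0 f1 r p = -(Zc⁻¹ * Mw p) *
      ∑ i, p i * ∑ j, (∫ r', g r r' * ρ0 r' * Z1 r r' i j) * a r j := by
    rw [N0, ← divP_Mw_mul]
    congr 1
    funext q i
    simp only [hA, hpg0, hpg1, mul_zero, Finset.sum_const_zero, integral_zero, zero_mul, add_zero,
      Finset.mul_sum]
    exact Finset.sum_congr rfl fun j _ => by ring
  have hN10 (r p : V3) : N0 g Z1 Z2 f1 f0 r p = -(Zc⁻¹ * Mw p) *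
      ∑ i, p i * (ρ0 r * ∫ r', g r r' * ∑ j, Z2 r r' i j * a r' j) := by
    rw [N0, ← divP_Mw_mul]
    congr 1
    funext q i
    simp only [hB, hpg0, mul_zero, Finset.sum_const_zero, zero_add, hf0]
    ring
  have key (r p : V3) :
      L0 f1 r p + N0 g Z1 Z2 f0 f1 r p + N0 g Z1 Z2 f1 f0 r p =
        -(Zc⁻¹ * Mw p) *
          ∑ i, p i *
            (a r i + (∑ j, (∫ r', g r r' * ρ0 r' * Z1 r r' i j) * a r j)
              + ρ0 r * ∫ r', g r r' * ∑ j, Z2 r r' i j * a r' j) := by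
    rw [hL, hN01, hN10]
    simp only [mul_add, Finset.sum_add_distrib]
  refine ⟨key, fun at' hat r i => ?_⟩
  have h := (key r (Pi.single i 1)).symm.trans (hat r (Pi.single i 1))
  have hne : Zc⁻¹ * Mw (Pi.single i 1) ≠ 0 :=
    (mul_pos (inv_pos.2 Zc_pos) (Real.exp_pos _)).ne'
  rw [neg_mul, ← mul_neg] at h
  have h := mul_left_cancel₀ hne h
  simp only [Pi.single_apply, ite_mul, one_mul, zero_mul, mul_ite, mul_one, mul_zero,
    Finset.sum_ite_eq', Finset.mem_univ, if_true] at h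
  linarith
end
end

section
/- Let f₁(r,p) := Z⁻¹ M(p) ( a(r)·p + ψ(r) ) with a : ℝ³ → ℝ³ and ψ : ℝ³ → ℝ continuously differentiable, and let V₁ : ℝ³ → ℝ be continuously differentiable. Then L₁f₁(r,p) = Z⁻¹ M(p) [ − p·(∇_r a(r)) p − p·∇_r ψ(r) + ∇_r V₁(r) · ( a(r) − p ( p·a(r) + ψ(r) ) ) ], where ∇_r a is the Jacobian matrix (∂_{r_j} a_i) and p·(∇_r a)p = Σ_{i,j} p_i p_j ∂_{r_i} a_j(r). -/
open MeasureTheory Real Finset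

noncomputable section

theorem HasFDerivAt.pd_eq {f : V3 → ℝ} {f' : V3 →L[ℝ] ℝ} {x : V3} (h : HasFDerivAt f f' x)
    (i : Fin 3) : pd i f x = f' (Pi.single i 1) := by
  rw [pd, h.fderiv]

theorem pd_add {f g : V3 → ℝ} {x : V3} (i : Fin 3) (hf : DifferentiableAt ℝ f x)
    (hg : DifferentiableAt ℝ g x) : pd i (fun s => f s + g s) x = pd i f x + pd i g x := by
  rw [(hf.hasFDerivAt.fun_add hg.hasFDerivAt).pd_eq]
  rfl

theorem pd_mul {f g : V3 → ℝ} {x : V3} (i : Fin 3) (hf : DifferentiableAt ℝ f x)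
    (hg : DifferentiableAt ℝ g x) :
    pd i (fun s => f s * g s) x = pd i f x * g x + f x * pd i g x := by
  rw [(hf.hasFDerivAt.fun_mul hg.hasFDerivAt).pd_eq]
  simp only [pd, add_apply, smul_apply, smul_eq_mul]
  ring

theorem pd_sum {ι : Type*} (u : Finset ι) {f : ι → V3 → ℝ} {x : V3} (i : Fin 3)
    (hf : ∀ j ∈ u, DifferentiableAt ℝ (f j) x) :
    pd i (fun s => ∑ j ∈ u, f j s) x = ∑ j ∈ u, pd i (f j) x := by
  rw [(HasFDerivAt.fun_sum fun j hj => (hf j hj).hasFDerivAt).pd_eq]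
  simp [pd]

theorem pd_const (i : Fin 3) (c : ℝ) (x : V3) : pd i (fun _ => c) x = 0 := by
  simp [pd]

theorem pd_coord (i j : Fin 3) (x : V3) :
    pd i (fun s => s j) x = if j = i then 1 else 0 := by
  rw [(hasFDerivAt_apply j x).pd_eq]
  simp [Pi.single_apply]

theorem differentiable_Mw : Differentiable ℝ Mw := by
  unfold Mw
  fun_prop

theorem pd_Mw (i : Fin 3) (p : V3) : pd i Mw p = -p i * Mw p := by
  have hq : DifferentiableAt ℝ (fun q : V3 => -(∑ j, q j ^ 2) / 2) p := by fun_prop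
  have hE : pd i (fun q : V3 => -(∑ j, q j ^ 2) / 2) p = -p i := by
    have heq : (fun q : V3 => -(∑ j, q j ^ 2) / 2) = fun q => (-1 / 2) * ∑ j, q j * q j := by
      funext q
      simp only [pow_two]
      ring
    rw [heq, pd_mul i (by fun_prop) (by fun_prop), pd_const,
      pd_sum _ i fun j _ => by fun_prop]
    have hj (j : Fin 3) : pd i (fun q : V3 => q j * q j) p = if j = i then 2 * p j else 0 := by
      rw [pd_mul i (by fun_prop) (by fun_prop), pd_coord]
      split_ifs <;> ring
    simp only [hj, Finset.sum_ite_eq', Finset.mem_univ, if_true]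
    ring
  have h := hq.hasFDerivAt.exp.pd_eq i
  rw [smul_apply, smul_eq_mul] at h
  change pd i (fun q => Real.exp (-(∑ j, q j ^ 2) / 2)) p = _
  rw [h, ← pd, hE, mul_comm, Mw]

/-- explicit formula for `L₁ f₁` when
`f₁(r,p) = Z⁻¹ M(p) (a(r)·p + ψ(r))`. -/
theorem stmt_12 (V1 : V3 → ℝ) (hV1 : ContDiff ℝ 1 V1)
    (a : V3 → V3) (ψ : V3 → ℝ)
    (ha : ContDiff ℝ 1 (fun r : V3 => a r)) (hψ : ContDiff ℝ 1 ψ)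
    (f1 : V3 → V3 → ℝ)
    (hf1 : ∀ r p, f1 r p = Zc⁻¹ * Mw p * (∑ i, a r i * p i + ψ r)) :
    ∀ r p, L1 V1 f1 r p =
      Zc⁻¹ * Mw p *
        (-(∑ i, ∑ j, p i * p j * pd i (fun s => a s j) r)
          - (∑ i, p i * pd i ψ r)
          + ∑ i, pd i V1 r * (a r i - p i * ((∑ j, p j * a r j) + ψ r))) := by
  intro r p
  have hψ' : Differentiable ℝ ψ := hψ.differentiable one_ne_zero
  have ha' (j : Fin 3) : Differentiable ℝ fun s => a s j :=
    differentiable_pi.1 (ha.differentiable one_ne_zero) j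
  have hr (i : Fin 3) : pd i (fun s => f1 s p) r =
      Zc⁻¹ * Mw p * (∑ j, p j * pd i (fun s => a s j) r + pd i ψ r) := by
    simp only [hf1]
    rw [pd_mul i (by fun_prop) (by fun_prop), pd_const,
      pd_add i (by fun_prop) (by fun_prop), pd_sum _ i fun j _ => by fun_prop]
    have hj (j : Fin 3) :
        pd i (fun s => a s j * p j) r = p j * pd i (fun s => a s j) r := by
      rw [pd_mul i (by fun_prop) (by fun_prop), pd_const]
      ring
    simp only [hj, zero_mul, zero_add]
  have hp (i : Fin 3) : pd i (f1 r) p =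
      Zc⁻¹ * Mw p * (a r i - p i * ((∑ j, p j * a r j) + ψ r)) := by
    have hM := differentiable_Mw
    rw [funext (hf1 r), pd_mul i (by fun_prop) (by fun_prop),
      pd_mul i (by fun_prop) (by fun_prop), pd_Mw, pd_const,
      pd_add i (by fun_prop) (by fun_prop), pd_const, pd_sum _ i fun j _ => by fun_prop]
    have hj (j : Fin 3) :
        pd i (fun q : V3 => a r j * q j) p = if j = i then a r j else 0 := by
      rw [pd_mul i (by fun_prop) (by fun_prop), pd_const, pd_coord]
      split_ifs <;> ring
    simp only [hj, Finset.sum_ite_eq', Finset.mem_univ, if_true, mul_comm (a r _) (p _)]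
    ring
  simp only [L1, hr, hp, Fin.sum_univ_three]
  ring
end
end
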